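/- Let L>0, M>0, T>L/M, ε∈(0,1), a∈(0,1), b∈(0,1], and C>0. Let ψ be an adjoint transport-diffusion solution, and assume the transformed function φ(t,x):=e^{M²t/(4ε²)+Mx/(2ε)}ψ(t/ε,x) satisfies ∫_0^∞∫_0^L e^{-L²/(2t)} φ(t,x)² dx dt ≤ C·∫_0^{bεT} (∂_xφ(t,0))² dt, with all integrals finite. Then ∫_0^L ψ(T,x)² dx ≤ (e^{(L²/(2aT) - M²T/2 + bM²T/2)/ε} / ((1-a)T))·C·∫_0^T (∂_xψ(t,0))² dt. -/

import Mathlib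

open MeasureTheory

/-- An "adjoint transport-diffusion solution" for parameters `L, M, ε`:
`ψ : [0,∞) × [0,L] → ℝ` continuous, `C¹` in `t` and `C²` in `x` on `(0,∞) × [0,L]`,
with `∂_t ψ - ε ∂_{xx} ψ - M ∂_x ψ = 0` for `t > 0`, `x ∈ (0,L)`, and
`ψ(t,0) = ψ(t,L) = 0` for all `t ≥ 0`.  The derivatives are the data `ψt`, `ψx`, `ψxx`. -/
structure IsAdjointTDSol (L M ε : ℝ) (ψ ψt ψx ψxx : ℝ → ℝ → ℝ) : Prop where
  cont : ContinuousOn (fun p : ℝ × ℝ => ψ p.1 p.2) (Set.Ici 0 ×ˢ Set.Icc 0 L)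
  ht : ∀ t > (0 : ℝ), ∀ x ∈ Set.Icc (0 : ℝ) L,
    HasDerivAt (fun τ => ψ τ x) (ψt t x) t
  htc : ∀ x ∈ Set.Icc (0 : ℝ) L, ContinuousOn (fun t => ψt t x) (Set.Ioi 0)
  hx : ∀ t > (0 : ℝ), ∀ x ∈ Set.Icc (0 : ℝ) L,
    HasDerivWithinAt (fun ξ => ψ t ξ) (ψx t x) (Set.Icc 0 L) x
  hxc : ∀ t > (0 : ℝ), ContinuousOn (fun x => ψx t x) (Set.Icc 0 L)
  hxx : ∀ t > (0 : ℝ), ∀ x ∈ Set.Icc (0 : ℝ) L,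
    HasDerivWithinAt (fun ξ => ψx t ξ) (ψxx t x) (Set.Icc 0 L) x
  hxxc : ∀ t > (0 : ℝ), ContinuousOn (fun x => ψxx t x) (Set.Icc 0 L)
  pde : ∀ t > (0 : ℝ), ∀ x ∈ Set.Ioo (0 : ℝ) L,
    ψt t x - ε * ψxx t x - M * ψx t x = 0
  bc0 : ∀ t ≥ (0 : ℝ), ψ t 0 = 0
  bcL : ∀ t ≥ (0 : ℝ), ψ t L = 0

section HeatSubsolution

open Set Filter Topology

theorem IsLocalMax.hasDerivAt_hasDerivAt_nonpos {u u' : ℝ → ℝ} {u'' x : ℝ}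
    (hmax : IsLocalMax u x) (h1 : ∀ᶠ y in 𝓝 x, HasDerivAt u (u' y) y)
    (h2 : HasDerivAt u' u'' x) : u'' ≤ 0 := by
  by_contra! hpos
  have hd : deriv u =ᶠ[𝓝 x] u' := h1.mono fun y hy => hy.deriv
  have hdd : deriv (deriv u) x = u'' := by rw [hd.deriv_eq, h2.deriv]
  have hmin : IsLocalMin u x := isLocalMin_of_deriv_deriv_pos (hdd ▸ hpos) hmax.deriv_eq_zero
    h1.self_of_nhds.continuousAt
  have hconst : u =ᶠ[𝓝 x] fun _ => u x := by
    filter_upwards [hmax, hmin] with y hy hy' using le_antisymm hy hy'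
  have := hconst.deriv.deriv_eq
  simp [hdd] at this
  exact hpos.ne' this

theorem HasDerivAt.nonneg_of_forall_le_left {f : ℝ → ℝ} {f' t₀ t : ℝ} (hf : HasDerivAt f f' t)
    (ht : t₀ < t) (hmax : ∀ s ∈ Icc t₀ t, f s ≤ f t) : 0 ≤ f' := by
  have h := (hasDerivWithinAt_iff_tendsto_slope' (s := Iio t) (by simp)).1 hf.hasDerivWithinAt
  refine ge_of_tendsto h ?_
  filter_upwards [Ioo_mem_nhdsLT ht] with s hs
  rw [slope_def_field]
  exact div_nonneg_of_nonpos (by linarith [hmax s ⟨hs.1.le, hs.2.le⟩]) (by linarith [hs.2])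

/-- Weak maximum principle for strict subsolutions of the heat equation on a rectangle. -/
theorem nonpos_of_strict_heat_subsolution {L ε t₀ t₁ : ℝ} (hε : 0 ≤ ε)
    {u ut ux uxx : ℝ → ℝ → ℝ}
    (hc : ContinuousOn (fun p : ℝ × ℝ => u p.1 p.2) (Icc t₀ t₁ ×ˢ Icc 0 L))
    (ht : ∀ t ∈ Ioc t₀ t₁, ∀ x ∈ Ioo 0 L, HasDerivAt (fun s => u s x) (ut t x) t)
    (hx : ∀ t ∈ Ioc t₀ t₁, ∀ x ∈ Ioo 0 L, HasDerivAt (u t) (ux t x) x)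
    (hxx : ∀ t ∈ Ioc t₀ t₁, ∀ x ∈ Ioo 0 L, HasDerivAt (ux t) (uxx t x) x)
    (hlt : ∀ t ∈ Ioc t₀ t₁, ∀ x ∈ Ioo 0 L, ut t x < ε * uxx t x)
    (hinit : ∀ x ∈ Icc 0 L, u t₀ x ≤ 0)
    (hleft : ∀ t ∈ Icc t₀ t₁, u t 0 ≤ 0) (hright : ∀ t ∈ Icc t₀ t₁, u t L ≤ 0) :
    ∀ t ∈ Icc t₀ t₁, ∀ x ∈ Icc 0 L, u t x ≤ 0 := by
  intro t htm x hxm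
  obtain ⟨⟨s, y⟩, ⟨hs, hy⟩, hmax⟩ := (isCompact_Icc.prod isCompact_Icc).exists_isMaxOn
    ⟨(t, x), htm, hxm⟩ hc
  dsimp only at hs hy
  have hmax' : ∀ s' ∈ Icc t₀ t₁, ∀ y' ∈ Icc 0 L, u s' y' ≤ u s y :=
    fun s' hs' y' hy' => hmax (mk_mem_prod hs' hy')
  refine (hmax' t htm x hxm).trans ?_
  rcases hs.1.eq_or_lt with rfl | hs0
  · exact hinit y hy
  rcases hy.1.eq_or_lt with rfl | hy0
  · exact hleft s hs
  rcases hy.2.eq_or_lt with rfl | hyL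
  · exact hright s hs
  have hs' : s ∈ Ioc t₀ t₁ := ⟨hs0, hs.2⟩
  have hy' : y ∈ Ioo 0 L := ⟨hy0, hyL⟩
  have hnhds : ∀ᶠ z in 𝓝 y, z ∈ Ioo 0 L := Ioo_mem_nhds hy0 hyL
  have h1 : 0 ≤ ut s y := (ht s hs' y hy').nonneg_of_forall_le_left hs0
    fun r hr => hmax' r ⟨hr.1, hr.2.trans hs.2⟩ y hy
  have h2 : uxx s y ≤ 0 := IsLocalMax.hasDerivAt_hasDerivAt_nonpos
    (hnhds.mono fun z hz => hmax' s hs z (Ioo_subset_Icc_self hz))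
    (hnhds.mono fun z hz => hx s hs' z hz) (hxx s hs' y hy')
  nlinarith [hlt s hs' y hy', mul_nonneg hε (neg_nonneg.2 h2)]

/-- The heat kernel on the real line. -/
noncomputable def heatKernel (τ z : ℝ) : ℝ := Real.exp (-z ^ 2 / (4 * τ)) / √(4 * Real.pi * τ)

theorem heatKernel_nonneg (τ z : ℝ) : 0 ≤ heatKernel τ z := by unfold heatKernel; positivity

theorem heatKernel_eq (τ : ℝ) : heatKernel τ =
    fun z => Real.exp (-(1 / (4 * τ)) * z ^ 2) / √(4 * Real.pi * τ) := by
  ext z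
  unfold heatKernel
  congr 2
  ring

theorem integrable_heatKernel {τ : ℝ} (hτ : 0 < τ) : Integrable (heatKernel τ) := by
  rw [heatKernel_eq]
  exact (integrable_exp_neg_mul_sq (by positivity)).div_const _

theorem integral_heatKernel {τ : ℝ} (hτ : 0 < τ) : ∫ z, heatKernel τ z = 1 := by
  rw [heatKernel_eq, integral_div, integral_gaussian]
  have : Real.pi / (1 / (4 * τ)) = 4 * Real.pi * τ := by field_simp
  rw [this, div_self (by positivity)]

theorem hasDerivAt_heatKernel_space {τ : ℝ} (hτ : 0 < τ) (z : ℝ) :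
    HasDerivAt (heatKernel τ) (-z / (2 * τ) * heatKernel τ z) z := by
  have h := ((((hasDerivAt_id z).pow 2).neg.div_const (4 * τ)).exp).div_const
    (√(4 * Real.pi * τ))
  refine h.congr_deriv ?_
  simp only [heatKernel, id, Pi.pow_apply, Pi.neg_apply]
  field_simp
  norm_num
  ring

theorem hasDerivAt_heatKernel_space_space {τ : ℝ} (hτ : 0 < τ) (z : ℝ) :
    HasDerivAt (fun z => -z / (2 * τ) * heatKernel τ z)
      ((z ^ 2 / (4 * τ ^ 2) - 1 / (2 * τ)) * heatKernel τ z) z := by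
  have h := ((hasDerivAt_id z).neg.div_const (2 * τ)).mul (hasDerivAt_heatKernel_space hτ z)
  refine h.congr_deriv ?_
  simp only [id, Pi.neg_apply]
  field_simp
  ring

theorem hasDerivAt_heatKernel_time {τ : ℝ} (hτ : 0 < τ) (z : ℝ) :
    HasDerivAt (fun τ => heatKernel τ z)
      ((z ^ 2 / (4 * τ ^ 2) - 1 / (2 * τ)) * heatKernel τ z) τ := by
  have hs : 0 < √(4 * Real.pi * τ) := by positivity
  have h1 : HasDerivAt (fun τ : ℝ => -z ^ 2 / (4 * τ)) (z ^ 2 / (4 * τ ^ 2)) τ := by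
    refine ((hasDerivAt_const τ (-z ^ 2)).div ((hasDerivAt_id τ).const_mul 4)
      (by simpa using hτ.ne')).congr_deriv ?_
    simp only [id]
    field_simp
    ring
  have h2 := ((hasDerivAt_id τ).const_mul (4 * Real.pi)).sqrt (by simp; positivity)
  refine (h1.exp.div h2 hs.ne').congr_deriv ?_
  simp only [heatKernel, id]
  have hsq : √(4 * Real.pi * τ) ^ 2 = 4 * Real.pi * τ := Real.sq_sqrt (by positivity)
  generalize √(4 * Real.pi * τ) = r at *
  field_simp
  rw [hsq]
  ring

theorem continuousOn_heatKernel :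
    ContinuousOn (fun p : ℝ × ℝ => heatKernel p.1 p.2) (Ioi 0 ×ˢ univ) := by
  unfold heatKernel
  refine ContinuousOn.div (ContinuousOn.rexp (ContinuousOn.div (by fun_prop) (by fun_prop) ?_))
    (by fun_prop) ?_
  · rintro p ⟨hp, -⟩
    have : 0 < p.1 := hp
    positivity
  · rintro p ⟨hp, -⟩
    have : 0 < p.1 := hp
    positivity

theorem sq_mul_heatKernel_le {τ : ℝ} (hτ : 0 < τ) (z : ℝ) :
    z ^ 2 * heatKernel τ z ≤ 16 * τ * heatKernel (2 * τ) z := by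
  have hr : √(4 * Real.pi * (2 * τ)) ≤ 2 * √(4 * Real.pi * τ) := by
    rw [Real.sqrt_le_left (by positivity), mul_pow, Real.sq_sqrt (by positivity)]
    nlinarith [Real.pi_pos, mul_pos Real.pi_pos hτ]
  have he : Real.exp (-z ^ 2 / (4 * τ)) =
      Real.exp (-z ^ 2 / (4 * (2 * τ))) * Real.exp (-z ^ 2 / (4 * (2 * τ))) := by
    rw [← Real.exp_add]
    congr 1
    field_simp
    ring
  have hz : z ^ 2 * Real.exp (-z ^ 2 / (4 * (2 * τ))) ≤ 8 * τ := by
    have := Real.add_one_le_exp (z ^ 2 / (4 * (2 * τ)))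
    rw [neg_div, Real.exp_neg, ← div_eq_mul_inv, div_le_iff₀ (Real.exp_pos _)]
    calc z ^ 2 = 8 * τ * (z ^ 2 / (4 * (2 * τ))) := by field_simp; ring
      _ ≤ _ := by gcongr; linarith
  unfold heatKernel
  rw [he]
  set e := Real.exp (-z ^ 2 / (4 * (2 * τ)))
  have hepos : 0 < e := Real.exp_pos _
  calc z ^ 2 * (e * e / √(4 * Real.pi * τ)) = (z ^ 2 * e) * e * 2 / (2 * √(4 * Real.pi * τ)) := by
        field_simp
    _ ≤ (8 * τ) * e * 2 / √(4 * Real.pi * (2 * τ)) := by gcongr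
    _ = _ := by ring

theorem hasDerivAt_intervalIntegral_of_continuousOn {U : Set ℝ} (hU : IsOpen U)
    {G G' : ℝ → ℝ → ℝ} (a b : ℝ)
    (hG : ContinuousOn (fun q : ℝ × ℝ => G q.1 q.2) (U ×ˢ univ))
    (hG' : ContinuousOn (fun q : ℝ × ℝ => G' q.1 q.2) (U ×ˢ univ))
    (hd : ∀ p ∈ U, ∀ y, HasDerivAt (fun p => G p y) (G' p y) p) {p : ℝ} (hp : p ∈ U) :
    HasDerivAt (fun p => ∫ y in a..b, G p y) (∫ y in a..b, G' p y) p := by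
  obtain ⟨r, hr, hball⟩ := Metric.nhds_basis_closedBall.mem_iff.1 (hU.mem_nhds hp)
  have hslice : ∀ {H : ℝ → ℝ → ℝ}, ContinuousOn (fun q : ℝ × ℝ => H q.1 q.2) (U ×ˢ univ) →
      ∀ q ∈ U, Continuous (H q) := fun {H} hH q hq => continuousOn_univ.1
    (hH.comp (f := fun y : ℝ => (q, y)) (by fun_prop) fun y _ => ⟨hq, mem_univ y⟩)
  obtain ⟨K, hK⟩ := ((isCompact_closedBall p r).prod (isCompact_uIcc (a := a) (b := b)))
    |>.exists_bound_of_continuousOn (hG'.mono (prod_mono hball (subset_univ _)))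
  refine (intervalIntegral.hasDerivAt_integral_of_dominated_loc_of_deriv_le
    (bound := fun _ => K) (Metric.closedBall_mem_nhds p hr) ?_
    ((hslice hG p hp).intervalIntegrable _ _) (hslice hG' p hp).aestronglyMeasurable
    ?_ (by simp) ?_).2
  · filter_upwards [hU.mem_nhds hp] with q hq using (hslice hG q hq).aestronglyMeasurable
  · exact Eventually.of_forall fun y hy q hq => hK (q, y) ⟨hq, uIoc_subset_uIcc hy⟩
  · exact Eventually.of_forall fun y _ q hq => hd q (hball hq) y

/-- The heat flow on the line, started from the restriction of `F` to `[0, L]`. -/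
noncomputable def heatFlow (L : ℝ) (F : ℝ → ℝ) (τ x : ℝ) : ℝ :=
  ∫ y in (0 : ℝ)..L, heatKernel τ (x - y) * F y

section heatFlow

variable {L : ℝ} {F : ℝ → ℝ}

theorem heatFlow_nonneg (hL : 0 ≤ L) (hF0 : ∀ y, 0 ≤ F y) (τ x : ℝ) : 0 ≤ heatFlow L F τ x :=
  intervalIntegral.integral_nonneg hL fun y _ => mul_nonneg (heatKernel_nonneg _ _) (hF0 y)

theorem continuousOn_heatFlow (hF : Continuous F) :
    ContinuousOn (fun p : ℝ × ℝ => heatFlow L F p.1 p.2) (Ioi 0 ×ˢ univ) := by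
  rw [continuousOn_iff_continuous_domRestrict]
  refine intervalIntegral.continuous_parametric_intervalIntegral_of_continuous'
    (f := fun (p : (Ioi (0 : ℝ) ×ˢ (univ : Set ℝ) : Set (ℝ × ℝ))) y =>
      heatKernel p.1.1 (p.1.2 - y) * F y) ?_ 0 L
  refine Continuous.mul ?_ (by fun_prop)
  exact continuousOn_heatKernel.comp_continuous
    (f := fun q : (Ioi (0 : ℝ) ×ˢ (univ : Set ℝ) : Set (ℝ × ℝ)) × ℝ => (q.1.1.1, q.1.1.2 - q.2))
    (by fun_prop) fun q => ⟨q.1.2.1, mem_univ _⟩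

theorem continuous_heatKernel {τ : ℝ} (hτ : 0 < τ) : Continuous (heatKernel τ) :=
  continuous_iff_continuousAt.2 fun z => (hasDerivAt_heatKernel_space hτ z).continuousAt

/-- The spatial derivative of `heatFlow`. -/
noncomputable def heatFlowDeriv (L : ℝ) (F : ℝ → ℝ) (τ x : ℝ) : ℝ :=
  ∫ y in (0 : ℝ)..L, (-(x - y) / (2 * τ) * heatKernel τ (x - y)) * F y

/-- The Laplacian of `heatFlow`. -/
noncomputable def heatFlowLaplacian (L : ℝ) (F : ℝ → ℝ) (τ x : ℝ) : ℝ :=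
  ∫ y in (0 : ℝ)..L,
    (((x - y) ^ 2 / (4 * τ ^ 2) - 1 / (2 * τ)) * heatKernel τ (x - y)) * F y

theorem hasDerivAt_heatFlow_space (hF : Continuous F) {τ : ℝ} (hτ : 0 < τ) (x : ℝ) :
    HasDerivAt (heatFlow L F τ) (heatFlowDeriv L F τ x) x := by
  have hk := continuous_heatKernel hτ
  refine hasDerivAt_intervalIntegral_of_continuousOn isOpen_univ
    (G := fun x y => heatKernel τ (x - y) * F y)
    (G' := fun x y => (-(x - y) / (2 * τ) * heatKernel τ (x - y)) * F y) 0 L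
    (Continuous.continuousOn (by fun_prop)) (Continuous.continuousOn (by fun_prop))
    (fun p _ y => ?_) (mem_univ x)
  exact ((hasDerivAt_heatKernel_space hτ (p - y)).comp_sub_const p y).mul_const _

theorem hasDerivAt_heatFlowDeriv (hF : Continuous F) {τ : ℝ} (hτ : 0 < τ) (x : ℝ) :
    HasDerivAt (heatFlowDeriv L F τ) (heatFlowLaplacian L F τ x) x := by
  have hk := continuous_heatKernel hτ
  refine hasDerivAt_intervalIntegral_of_continuousOn isOpen_univ
    (G := fun x y => (-(x - y) / (2 * τ) * heatKernel τ (x - y)) * F y)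
    (G' := fun x y => (((x - y) ^ 2 / (4 * τ ^ 2) - 1 / (2 * τ)) * heatKernel τ (x - y)) * F y)
    0 L (Continuous.continuousOn (by fun_prop)) (Continuous.continuousOn (by fun_prop))
    (fun p _ y => ?_) (mem_univ x)
  exact ((hasDerivAt_heatKernel_space_space hτ (p - y)).comp_sub_const p y).mul_const _

theorem hasDerivAt_heatFlow_time (hF : Continuous F) {τ : ℝ} (hτ : 0 < τ) (x : ℝ) :
    HasDerivAt (fun τ => heatFlow L F τ x) (heatFlowLaplacian L F τ x) τ := by
  have hk : ContinuousOn (fun q : ℝ × ℝ => heatKernel q.1 (x - q.2)) (Ioi 0 ×ˢ univ) :=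
    continuousOn_heatKernel.comp (f := fun q : ℝ × ℝ => (q.1, x - q.2)) (by fun_prop)
      fun q hq => ⟨hq.1, mem_univ _⟩
  refine hasDerivAt_intervalIntegral_of_continuousOn isOpen_Ioi
    (G := fun τ y => heatKernel τ (x - y) * F y)
    (G' := fun τ y => (((x - y) ^ 2 / (4 * τ ^ 2) - 1 / (2 * τ)) * heatKernel τ (x - y)) * F y)
    0 L (hk.mul (by fun_prop)) ((ContinuousOn.mul (ContinuousOn.sub
      (ContinuousOn.div (by fun_prop) (by fun_prop) ?_)
      (ContinuousOn.div (by fun_prop) (by fun_prop) ?_)) hk).mul (by fun_prop))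
    (fun p hp y => (hasDerivAt_heatKernel_time hp (x - y)).mul_const _) (mem_Ioi.2 hτ)
  all_goals
    rintro q ⟨hq, -⟩
    have : 0 < q.1 := hq
    positivity

theorem integral_heatFlow_le (hL : 0 ≤ L) (hF : Continuous F) (hF0 : ∀ y, 0 ≤ F y) {τ : ℝ}
    (hτ : 0 < τ) : ∫ x in (0 : ℝ)..L, heatFlow L F τ x ≤ ∫ y in (0 : ℝ)..L, F y := by
  have hk := continuous_heatKernel hτ
  have hcont : Continuous (fun q : ℝ × ℝ => heatKernel τ (q.1 - q.2) * F q.2) := by fun_prop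
  have hswap : ∫ x in (0 : ℝ)..L, heatFlow L F τ x =
      ∫ y in (0 : ℝ)..L, ∫ x in (0 : ℝ)..L, heatKernel τ (x - y) * F y :=
    intervalIntegral_intervalIntegral_swap
      ((hcont.continuousOn.integrableOn_compact
        (isCompact_uIcc (a := 0) (b := L) |>.prod (isCompact_uIcc (a := 0) (b := L)))).mono_set
        (prod_mono uIoc_subset_uIcc uIoc_subset_uIcc))
  rw [hswap]
  refine intervalIntegral.integral_mono_on hL (Continuous.intervalIntegrable
    (intervalIntegral.continuous_parametric_intervalIntegral_of_continuous'
      (f := fun y x => heatKernel τ (x - y) * F y) (hcont.comp continuous_swap) 0 L) _ _)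
    (hF.intervalIntegrable _ _) fun y _ => ?_
  rw [intervalIntegral.integral_mul_const]
  refine mul_le_of_le_one_left (hF0 y) ?_
  rw [intervalIntegral.integral_of_le hL, ← integral_heatKernel hτ,
    ← integral_sub_right_eq_self (heatKernel τ) y]
  exact setIntegral_le_integral ((integrable_heatKernel hτ).comp_sub_right y)
    (Eventually.of_forall fun x => heatKernel_nonneg _ _)

theorem exists_le_heatFlow_add (hL : 0 ≤ L) (hF : Continuous F) (hF0 : ∀ y, 0 ≤ F y)
    (hsupp : ∀ y ∉ Ioc 0 L, F y = 0) {η : ℝ} (hη : 0 < η) :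
    ∃ δ > 0, ∀ x, F x ≤ heatFlow L F δ x + η := by
  have hcs : HasCompactSupport F := HasCompactSupport.intro (isCompact_Icc (a := 0) (b := L))
    fun y hy => hsupp y fun h => hy (Ioc_subset_Icc_self h)
  obtain ⟨K, hK⟩ := hcs.exists_bound_of_continuous hF
  have hFK : ∀ y, F y ≤ K := fun y => (le_abs_self _).trans (hK y)
  have hK0 : 0 ≤ K := (hF0 0).trans (hFK 0)
  obtain ⟨ρ, hρ, hunif⟩ := Metric.uniformContinuous_iff.1
    (hcs.uniformContinuous_of_continuous hF) (η / 2) (by positivity)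
  have hdiff : ∀ x y, F x - F y ≤ η / 2 + K / ρ ^ 2 * (x - y) ^ 2 := by
    intro x y
    rcases lt_or_ge (dist x y) ρ with h | h
    · have h1 := hunif h
      rw [Real.dist_eq] at h1
      have : 0 ≤ K / ρ ^ 2 * (x - y) ^ 2 := by positivity
      linarith [le_abs_self (F x - F y)]
    · have h1 : ρ ^ 2 ≤ (x - y) ^ 2 := by
        rw [← sq_abs (x - y), ← Real.dist_eq]
        gcongr
      have h2 : K ≤ K / ρ ^ 2 * (x - y) ^ 2 := by
        rw [div_mul_eq_mul_div, le_div_iff₀ (by positivity)]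
        gcongr
      linarith [hFK x, hF0 y]
  generalize hc : K / ρ ^ 2 = c at hdiff
  have hc0 : 0 ≤ c := hc ▸ by positivity
  set δ := η / (32 * (c + 1)) with hδ
  have hδ0 : 0 < δ := by positivity
  have hcδ : 16 * δ * c ≤ η / 2 := by
    rw [hδ, mul_div_assoc', div_mul_eq_mul_div, div_le_iff₀ (by positivity)]
    nlinarith
  refine ⟨δ, hδ0, fun x => ?_⟩
  have hi : ∀ τ : ℝ, 0 < τ → Integrable (fun y => heatKernel τ (x - y)) := fun τ hτ =>
    (integrable_heatKernel hτ).comp_sub_left x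
  have hone : ∀ τ : ℝ, 0 < τ → ∫ y, heatKernel τ (x - y) = 1 := fun τ hτ => by
    rw [integral_sub_left_eq_self (heatKernel τ) volume x, integral_heatKernel hτ]
  have hiF : Integrable (fun y => heatKernel δ (x - y) * F y) :=
    (hi δ hδ0).mul_bdd (c := K) hF.aestronglyMeasurable (Eventually.of_forall hK)
  have hflow : heatFlow L F δ x = ∫ y, heatKernel δ (x - y) * F y := by
    rw [heatFlow, intervalIntegral.integral_of_le hL]
    exact setIntegral_eq_integral_of_forall_compl_eq_zero fun y hy => by rw [hsupp y hy, mul_zero]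
  have hpt : ∀ y, heatKernel δ (x - y) * F x ≤ heatKernel δ (x - y) * F y +
      (η / 2 * heatKernel δ (x - y) + c * (16 * δ) * heatKernel (2 * δ) (x - y)) := by
    intro y
    have h1 := mul_le_mul_of_nonneg_left (hdiff x y) (heatKernel_nonneg δ (x - y))
    have h2 := mul_le_mul_of_nonneg_left (sq_mul_heatKernel_le hδ0 (x - y)) hc0
    linarith
  have hδ2 : 0 < 2 * δ := by positivity
  have hint := integral_mono ((hi δ hδ0).mul_const (F x))
    (hiF.add (((hi δ hδ0).const_mul (η / 2)).add ((hi _ hδ2).const_mul (c * (16 * δ))))) hpt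
  rw [integral_mul_const, integral_add' hiF (((hi δ hδ0).const_mul (η / 2)).add
    ((hi _ hδ2).const_mul (c * (16 * δ)))), integral_add' ((hi δ hδ0).const_mul (η / 2))
    ((hi _ hδ2).const_mul (c * (16 * δ))), integral_const_mul, integral_const_mul, hone δ hδ0,
    hone _ hδ2, ← hflow] at hint
  linarith

end heatFlow

/-- Nonnegative subsolutions of the heat equation that vanish on the lateral boundary have
nonincreasing integral. -/
theorem integral_le_of_heat_subsolution {L ε t₀ t₁ : ℝ} (hL : 0 < L) (hε : 0 < ε) (h01 : t₀ < t₁)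
    {v vt vx vxx : ℝ → ℝ → ℝ} (hv0 : ∀ t x, 0 ≤ v t x)
    (hc : ContinuousOn (fun p : ℝ × ℝ => v p.1 p.2) (Icc t₀ t₁ ×ˢ Icc 0 L))
    (ht : ∀ t ∈ Ioc t₀ t₁, ∀ x ∈ Ioo 0 L, HasDerivAt (fun s => v s x) (vt t x) t)
    (hx : ∀ t ∈ Ioc t₀ t₁, ∀ x ∈ Ioo 0 L, HasDerivAt (v t) (vx t x) x)
    (hxx : ∀ t ∈ Ioc t₀ t₁, ∀ x ∈ Ioo 0 L, HasDerivAt (vx t) (vxx t x) x)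
    (hle : ∀ t ∈ Ioc t₀ t₁, ∀ x ∈ Ioo 0 L, vt t x ≤ ε * vxx t x)
    (hleft : ∀ t ∈ Icc t₀ t₁, v t 0 = 0) (hright : ∀ t ∈ Icc t₀ t₁, v t L = 0) :
    ∫ x in (0 : ℝ)..L, v t₁ x ≤ ∫ x in (0 : ℝ)..L, v t₀ x := by
  have hslice : ∀ t ∈ Icc t₀ t₁, ContinuousOn (v t) (Icc 0 L) := fun t htm =>
    hc.comp (f := fun x : ℝ => (t, x)) (by fun_prop) fun x hxm => ⟨htm, hxm⟩
  have hm0 : t₀ ∈ Icc t₀ t₁ := left_mem_Icc.2 h01.le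
  have hm1 : t₁ ∈ Icc t₀ t₁ := right_mem_Icc.2 h01.le
  set F : ℝ → ℝ := IccExtend hL.le ((Icc 0 L).domRestrict (v t₀))
  have hFc : Continuous F := (hslice t₀ hm0).domRestrict.Icc_extend'
  have hF0 : ∀ y, 0 ≤ F y := fun y => hv0 _ _
  have hFeq : ∀ y ∈ Icc 0 L, F y = v t₀ y := fun y hy => IccExtend_of_mem _ _ hy
  have hsupp : ∀ y ∉ Ioc 0 L, F y = 0 := by
    intro y hy
    rcases le_or_gt y 0 with h | h
    · exact (IccExtend_of_le_left _ _ h).trans (hleft t₀ hm0)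
    · exact (IccExtend_of_right_le _ _ (not_lt.1 fun h' => hy ⟨h, h'.le⟩)).trans (hright t₀ hm0)
  have hFint : ∫ x in (0 : ℝ)..L, F x = ∫ x in (0 : ℝ)..L, v t₀ x :=
    intervalIntegral.integral_congr fun y hy => hFeq y (uIcc_of_le hL.le ▸ hy)
  rw [← hFint]
  refine le_of_forall_pos_le_add fun κ hκ => ?_
  set η := κ / (L * (1 + (t₁ - t₀))) with hη
  have h01' : 0 < t₁ - t₀ := sub_pos.2 h01
  have hη0 : 0 < η := by positivity
  obtain ⟨δ, hδ, happ⟩ := exists_le_heatFlow_add hL.le hFc hF0 hsupp hη0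
  have hτ : ∀ t, t₀ ≤ t → 0 < ε * (t - t₀) + δ := fun t h => by
    have := mul_nonneg hε.le (sub_nonneg.2 h)
    linarith
  have hcomp := nonpos_of_strict_heat_subsolution (L := L) (t₀ := t₀) (t₁ := t₁) hε.le
    (u := fun t x => v t x - heatFlow L F (ε * (t - t₀) + δ) x - η * (1 + (t - t₀)))
    (ut := fun t x => vt t x - heatFlowLaplacian L F (ε * (t - t₀) + δ) x * ε - η)
    (ux := fun t x => vx t x - heatFlowDeriv L F (ε * (t - t₀) + δ) x)
    (uxx := fun t x => vxx t x - heatFlowLaplacian L F (ε * (t - t₀) + δ) x)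
    ((hc.sub ((continuousOn_heatFlow hFc).comp
      (f := fun p : ℝ × ℝ => (ε * (p.1 - t₀) + δ, p.2)) (by fun_prop)
      fun p hp => ⟨hτ _ hp.1.1, mem_univ _⟩)).sub (by fun_prop))
    (fun t htm x hxm => ?_)
    (fun t htm x hxm => ((hx t htm x hxm).sub
      (hasDerivAt_heatFlow_space hFc (hτ t htm.1.le) x)).sub_const _)
    (fun t htm x hxm => (hxx t htm x hxm).sub
      (hasDerivAt_heatFlowDeriv hFc (hτ t htm.1.le) x))
    (fun t htm x hxm => by linarith [hle t htm x hxm])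
    (fun x hxm => ?_) (fun t htm => ?_) (fun t htm => ?_)
  · have hb : ∀ x ∈ Icc 0 L, v t₁ x ≤
        heatFlow L F (ε * (t₁ - t₀) + δ) x + η * (1 + (t₁ - t₀)) :=
      fun x hxm => by linarith [hcomp t₁ hm1 x hxm]
    have hwi : IntervalIntegrable (heatFlow L F (ε * (t₁ - t₀) + δ)) volume 0 L :=
      Continuous.intervalIntegrable (continuous_iff_continuousAt.2 fun x =>
        (hasDerivAt_heatFlow_space hFc (hτ t₁ h01.le) x).continuousAt) _ _
    calc ∫ x in (0 : ℝ)..L, v t₁ x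
        ≤ ∫ x in (0 : ℝ)..L, (heatFlow L F (ε * (t₁ - t₀) + δ) x + η * (1 + (t₁ - t₀))) :=
          intervalIntegral.integral_mono_on hL.le
            ((hslice t₁ hm1).intervalIntegrable_of_Icc hL.le) (hwi.add (by simp)) hb
      _ = (∫ x in (0 : ℝ)..L, heatFlow L F (ε * (t₁ - t₀) + δ) x) + κ := by
          rw [intervalIntegral.integral_add hwi (by simp), intervalIntegral.integral_const,
            smul_eq_mul, hη]
          field_simp
          simp
          ring
      _ ≤ _ := by
          gcongr
          exact integral_heatFlow_le hL.le hFc hF0 (hτ t₁ h01.le)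
  · have h1 : HasDerivAt (fun s => ε * (s - t₀) + δ) ε t := by
      simpa using (((hasDerivAt_id t).sub_const t₀).const_mul ε).add_const δ
    have h2 : HasDerivAt (fun s => η * (1 + (s - t₀))) η t := by
      simpa using (((hasDerivAt_id t).sub_const t₀).const_add 1).const_mul η
    exact ((ht t htm x hxm).sub
      ((hasDerivAt_heatFlow_time hFc (hτ t htm.1.le) x).comp t h1)).sub h2
  · have := happ x
    rw [hFeq x hxm] at this
    simp only [sub_self, mul_zero, zero_add, add_zero, mul_one]
    linarith
  all_goals
    have h1 := heatFlow_nonneg hL.le hF0 (ε * (t - t₀) + δ)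
    have h2 : 0 ≤ η * (1 + (t - t₀)) := mul_nonneg hη0.le (by linarith [htm.1])
  · simp only [hleft t htm]
    linarith [h1 0]
  · simp only [hright t htm]
    linarith [h1 L]

/-- The squared `L²` norm of `e^{M²t/(4ε) + Mx/(2ε)} ψ(t, x)` at time `t`. -/
noncomputable def weightedEnergy (L M ε : ℝ) (ψ : ℝ → ℝ → ℝ) (t : ℝ) : ℝ :=
  ∫ x in (0 : ℝ)..L, Real.exp (M ^ 2 * t / (2 * ε) + M * x / ε) * ψ t x ^ 2

theorem IsAdjointTDSol.weightedEnergy_anti {L M ε : ℝ} {ψ ψt ψx ψxx : ℝ → ℝ → ℝ}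
    (hψ : IsAdjointTDSol L M ε ψ ψt ψx ψxx) (hL : 0 < L) (hε : 0 < ε) {s t : ℝ} (hs : 0 < s)
    (hst : s ≤ t) : weightedEnergy L M ε ψ t ≤ weightedEnergy L M ε ψ s := by
  rcases hst.eq_or_lt with rfl | hst
  · exact le_rfl
  have hexpx : ∀ r x : ℝ, HasDerivAt (fun x => Real.exp (M ^ 2 * r / (2 * ε) + M * x / ε))
      (Real.exp (M ^ 2 * r / (2 * ε) + M * x / ε) * (M / ε)) x := fun r x => by
    simpa using ((((hasDerivAt_id x).const_mul M).div_const ε).const_add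
      (M ^ 2 * r / (2 * ε))).exp
  have hexpt : ∀ r x : ℝ, HasDerivAt (fun r => Real.exp (M ^ 2 * r / (2 * ε) + M * x / ε))
      (Real.exp (M ^ 2 * r / (2 * ε) + M * x / ε) * (M ^ 2 / (2 * ε))) r := fun r x => by
    simpa using ((((hasDerivAt_id r).const_mul (M ^ 2)).div_const (2 * ε)).add_const
      (M * x / ε)).exp
  have hpos : ∀ r ∈ Ioc s t, 0 < r := fun r hr => hs.trans hr.1
  have hdx : ∀ r ∈ Ioc s t, ∀ x ∈ Ioo 0 L, HasDerivAt (ψ r) (ψx r x) x := fun r hr x hx =>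
    (hψ.hx r (hpos r hr) x (Ioo_subset_Icc_self hx)).hasDerivAt (Icc_mem_nhds hx.1 hx.2)
  have hdxx : ∀ r ∈ Ioc s t, ∀ x ∈ Ioo 0 L, HasDerivAt (ψx r) (ψxx r x) x := fun r hr x hx =>
    (hψ.hxx r (hpos r hr) x (Ioo_subset_Icc_self hx)).hasDerivAt (Icc_mem_nhds hx.1 hx.2)
  refine integral_le_of_heat_subsolution hL hε hst
    (v := fun r x => Real.exp (M ^ 2 * r / (2 * ε) + M * x / ε) * ψ r x ^ 2)
    (vt := fun r x => Real.exp (M ^ 2 * r / (2 * ε) + M * x / ε) *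
      (M ^ 2 / (2 * ε) * ψ r x ^ 2 + 2 * ψ r x * ψt r x))
    (vx := fun r x => Real.exp (M ^ 2 * r / (2 * ε) + M * x / ε) *
      (M / ε * ψ r x ^ 2 + 2 * ψ r x * ψx r x))
    (vxx := fun r x => Real.exp (M ^ 2 * r / (2 * ε) + M * x / ε) *
      ((M / ε) ^ 2 * ψ r x ^ 2 + 4 * (M / ε) * ψ r x * ψx r x + 2 * ψx r x ^ 2 +
        2 * ψ r x * ψxx r x))
    (fun r x => by positivity) ?_ (fun r hr x hx => ?_) (fun r hr x hx => ?_)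
    (fun r hr x hx => ?_) (fun r hr x hx => ?_) (fun r hr => ?_) (fun r hr => ?_)
  · exact ContinuousOn.mul (by fun_prop)
      ((hψ.cont.mono (prod_mono (Icc_subset_Ici_self.trans (Ici_subset_Ici.2 hs.le))
        subset_rfl)).pow 2)
  · refine ((hexpt r x).mul
      ((hψ.ht r (hpos r hr) x (Ioo_subset_Icc_self hx)).pow 2)).congr_deriv ?_
    simp only [Pi.pow_apply]
    ring
  · refine ((hexpx r x).mul ((hdx r hr x hx).pow 2)).congr_deriv ?_
    simp only [Pi.pow_apply]
    ring
  · refine ((hexpx r x).mul ((((hdx r hr x hx).pow 2).const_mul (M / ε)).add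
      (((hdx r hr x hx).const_mul 2).mul (hdxx r hr x hx)))).congr_deriv ?_
    simp only [Pi.pow_apply, Pi.add_apply, Pi.mul_apply]
    ring
  · have hpde : ψt r x = ε * ψxx r x + M * ψx r x := by
      linarith [hψ.pde r (hpos r hr) x hx]
    rw [mul_left_comm, hpde]
    refine mul_le_mul_of_nonneg_left ?_ (Real.exp_pos _).le
    have hsq : 0 ≤ 2 * ε * (ψx r x + M / (2 * ε) * ψ r x) ^ 2 := by positivity
    refine sub_nonneg.1 (hsq.trans_eq ?_)
    field_simp
    ring
  · simp [hψ.bc0 r (hs.le.trans hr.1)]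
  · simp [hψ.bcL r (hs.le.trans hr.1)]

theorem IsAdjointTDSol.exp_mul_integral_sq_le_weightedEnergy {L M ε : ℝ}
    {ψ ψt ψx ψxx : ℝ → ℝ → ℝ} (hψ : IsAdjointTDSol L M ε ψ ψt ψx ψxx) (hL : 0 ≤ L) (hM : 0 ≤ M)
    (hε : 0 < ε) {t : ℝ} (ht : 0 ≤ t) :
    Real.exp (M ^ 2 * t / (2 * ε)) * ∫ x in (0 : ℝ)..L, ψ t x ^ 2 ≤ weightedEnergy L M ε ψ t := by
  have hc : ContinuousOn (ψ t) (Icc 0 L) :=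
    hψ.cont.comp (f := fun x : ℝ => (t, x)) (by fun_prop) fun x hx => ⟨ht, hx⟩
  rw [← intervalIntegral.integral_const_mul]
  refine intervalIntegral.integral_mono_on hL
    (ContinuousOn.intervalIntegrable_of_Icc hL (by fun_prop))
    (ContinuousOn.intervalIntegrable_of_Icc hL (by fun_prop)) fun x hx => ?_
  have : 0 ≤ M * x / ε := div_nonneg (mul_nonneg hM hx.1) hε.le
  gcongr
  linarith

theorem integral_exp_mul_sq_comp_div_le {M ε T b : ℝ} {g : ℝ → ℝ} (hε : 0 < ε) (hT : 0 ≤ T)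
    (hb0 : 0 ≤ b) (hb1 : b ≤ 1)
    (hInt : IntervalIntegrable (fun t => (Real.exp (M ^ 2 * t / (4 * ε ^ 2)) * g (t / ε)) ^ 2)
      volume 0 (b * ε * T))
    (hg : IntervalIntegrable (fun t => g t ^ 2) volume 0 T) :
    ∫ t in (0 : ℝ)..(b * ε * T), (Real.exp (M ^ 2 * t / (4 * ε ^ 2)) * g (t / ε)) ^ 2 ≤
      ε * Real.exp (b * M ^ 2 * T / (2 * ε)) * ∫ t in (0 : ℝ)..T, g t ^ 2 := by
  have hbT : b * T ≤ T := mul_le_of_le_one_left hT hb1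
  have hbT0 : 0 ≤ b * T := mul_nonneg hb0 hT
  have hgb : IntervalIntegrable (fun t => g t ^ 2) volume 0 (b * T) :=
    hg.mono_set (uIcc_subset_uIcc left_mem_uIcc (mem_uIcc.2 (Or.inl ⟨hbT0, hbT⟩)))
  have hbε : b * ε * T / ε = b * T := by field_simp
  have hgc : IntervalIntegrable (fun t => g (t / ε) ^ 2) volume 0 (b * ε * T) := by
    have := hgb.comp_mul_right (c := ε⁻¹)
    simp only [div_inv_eq_mul, zero_mul] at this
    rwa [mul_right_comm b T ε] at this
  have hle : ∫ t in (0 : ℝ)..(b * ε * T), (Real.exp (M ^ 2 * t / (4 * ε ^ 2)) * g (t / ε)) ^ 2 ≤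
      ∫ t in (0 : ℝ)..(b * ε * T), Real.exp (b * M ^ 2 * T / (2 * ε)) * g (t / ε) ^ 2 := by
    refine intervalIntegral.integral_mono_on (by positivity) hInt (hgc.const_mul _)
      fun t ht => ?_
    rw [mul_pow, ← Real.exp_nat_mul]
    gcongr
    calc ((2 : ℕ) : ℝ) * (M ^ 2 * t / (4 * ε ^ 2)) = M ^ 2 * t / (2 * ε ^ 2) := by
          push_cast
          field_simp
          ring
      _ ≤ M ^ 2 * (b * ε * T) / (2 * ε ^ 2) := by gcongr; exact ht.2
      _ = _ := by field_simp
  refine hle.trans ?_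
  rw [intervalIntegral.integral_const_mul,
    intervalIntegral.integral_comp_div (fun t => g t ^ 2) hε.ne', hbε, zero_div, smul_eq_mul,
    ← mul_assoc, mul_comm (Real.exp _)]
  gcongr
  exact intervalIntegral.integral_mono_interval le_rfl hbT0 hbT
    (Eventually.of_forall fun t => sq_nonneg (g t)) hg

theorem IsAdjointTDSol.mul_weightedEnergy_le_integral {L M ε T a : ℝ}
    {ψ ψt ψx ψxx : ℝ → ℝ → ℝ} (hψ : IsAdjointTDSol L M ε ψ ψt ψx ψxx) (hL : 0 < L) (hε : 0 < ε)
    (hT : 0 < T) (ha0 : 0 < a) (ha1 : a < 1)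
    (hInt : IntegrableOn
      (fun t => ∫ x in (0 : ℝ)..L, Real.exp (-L ^ 2 / (2 * t)) *
        (Real.exp (M ^ 2 * t / (4 * ε ^ 2) + M * x / (2 * ε)) * ψ (t / ε) x) ^ 2)
      (Ioi 0)) :
    (1 - a) * (ε * T) * (Real.exp (-(L ^ 2 / (2 * a * T) / ε)) * weightedEnergy L M ε ψ T) ≤
      ∫ t in Ioi (0 : ℝ), ∫ x in (0 : ℝ)..L, Real.exp (-L ^ 2 / (2 * t)) *
        (Real.exp (M ^ 2 * t / (4 * ε ^ 2) + M * x / (2 * ε)) * ψ (t / ε) x) ^ 2 := by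
  have hεT : 0 < ε * T := by positivity
  have haT : 0 < a * (ε * T) := by positivity
  have haT1 : a * (ε * T) ≤ ε * T := mul_le_of_le_one_left hεT.le ha1.le
  have hE0 : ∀ t, 0 ≤ weightedEnergy L M ε ψ t := fun t =>
    intervalIntegral.integral_nonneg hL.le fun x _ => by positivity
  have heq : ∀ t, ∫ x in (0 : ℝ)..L, Real.exp (-L ^ 2 / (2 * t)) *
      (Real.exp (M ^ 2 * t / (4 * ε ^ 2) + M * x / (2 * ε)) * ψ (t / ε) x) ^ 2 =
      Real.exp (-L ^ 2 / (2 * t)) * weightedEnergy L M ε ψ (t / ε) := by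
    intro t
    rw [intervalIntegral.integral_const_mul, weightedEnergy]
    congr 2
    ext x
    rw [mul_pow, ← Real.exp_nat_mul]
    congr 2
    push_cast
    field_simp
    ring
  simp only [heq] at hInt ⊢
  have hsub : Ioc (a * (ε * T)) (ε * T) ⊆ Ioi 0 := fun t ht => haT.trans ht.1
  have hvol : volume.real (Ioc (a * (ε * T)) (ε * T)) = (1 - a) * (ε * T) := by
    rw [Real.volume_real_Ioc_of_le haT1]
    ring
  rw [← hvol, ← smul_eq_mul, ← setIntegral_const]
  refine (setIntegral_mono_on continuous_const.integrableOn_Ioc (hInt.mono_set hsub) measurableSet_Ioc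
    fun t ht => ?_).trans (setIntegral_mono_set hInt (Eventually.of_forall fun t =>
      mul_nonneg (Real.exp_pos _).le (hE0 _)) hsub.eventuallyLE)
  have ht0 : 0 < t := hsub ht
  have htT : t / ε ≤ T := (div_le_iff₀' hε).2 ht.2
  refine mul_le_mul (Real.exp_le_exp.2 ?_) (hψ.weightedEnergy_anti hL hε (by positivity) htT)
    (hE0 _) (Real.exp_pos _).le
  rw [neg_div, neg_le_neg_iff, div_div]
  exact div_le_div_of_nonneg_left (by positivity) (by positivity) (by linarith [ht.1])

end HeatSubsolution

/-- estimate (estez2) of the paper (case `M > 0`).  Let `L > 0`,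
`M > 0`, `T > L/M`, `ε ∈ (0,1)`, `a ∈ (0,1)`, `b ∈ (0,1]`, `C > 0`.  Let `ψ` be an
adjoint transport-diffusion solution and assume the transformed function
`φ(t,x) := e^{M²t/(4ε²) + Mx/(2ε)} ψ(t/ε, x)` (whose boundary normal derivative at
`x = 0` is `∂_x φ(t,0) = e^{M²t/(4ε²)} ψx(t/ε, 0)`) satisfies
`∫_0^∞ ∫_0^L e^{-L²/(2t)} φ(t,x)² dx dt ≤ C ∫_0^{bεT} (∂_x φ(t,0))² dt`,
all integrals being finite.  Then
`∫_0^L ψ(T,x)² dx ≤ (e^{(L²/(2aT) - M²T/2 + bM²T/2)/ε} / ((1-a)T)) · C ·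
  ∫_0^T (∂_x ψ(t,0))² dt`. -/
theorem estimate_estez2
    (L M ε T a b C : ℝ) (hL : 0 < L) (hM : 0 < M) (hT : L / M < T)
    (hε : ε ∈ Set.Ioo (0 : ℝ) 1) (ha : a ∈ Set.Ioo (0 : ℝ) 1)
    (hb : b ∈ Set.Ioc (0 : ℝ) 1) (hC : 0 < C)
    (ψ ψt ψx ψxx : ℝ → ℝ → ℝ)
    (hψ : IsAdjointTDSol L M ε ψ ψt ψx ψxx)
    (hInt1 : IntegrableOn
      (fun t => ∫ x in (0 : ℝ)..L, Real.exp (-L ^ 2 / (2 * t)) *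
        (Real.exp (M ^ 2 * t / (4 * ε ^ 2) + M * x / (2 * ε)) * ψ (t / ε) x) ^ 2)
      (Set.Ioi 0))
    (hInt2 : IntervalIntegrable
      (fun t => (Real.exp (M ^ 2 * t / (4 * ε ^ 2)) * ψx (t / ε) 0) ^ 2)
      volume 0 (b * ε * T))
    (hInt3 : IntervalIntegrable (fun t => (ψx t 0) ^ 2) volume 0 T)
    (hobs : (∫ t in Set.Ioi (0 : ℝ),
        ∫ x in (0 : ℝ)..L, Real.exp (-L ^ 2 / (2 * t)) *
          (Real.exp (M ^ 2 * t / (4 * ε ^ 2) + M * x / (2 * ε)) * ψ (t / ε) x) ^ 2) ≤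
      C * ∫ t in (0 : ℝ)..(b * ε * T),
        (Real.exp (M ^ 2 * t / (4 * ε ^ 2)) * ψx (t / ε) 0) ^ 2) :
    (∫ x in (0 : ℝ)..L, (ψ T x) ^ 2) ≤
      (Real.exp ((L ^ 2 / (2 * a * T) - M ^ 2 * T / 2 + b * M ^ 2 * T / 2) / ε) /
          ((1 - a) * T)) * C *
        ∫ t in (0 : ℝ)..T, (ψx t 0) ^ 2 := by
  obtain ⟨hε0, -⟩ := hε
  obtain ⟨ha0, ha1⟩ := ha
  obtain ⟨hb0, hb1⟩ := hb
  have hT0 : 0 < T := (div_pos hL hM).trans hT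
  have ha1' : 0 < 1 - a := sub_pos.2 ha1
  have hlower := hψ.mul_weightedEnergy_le_integral hL hε0 hT0 ha0 ha1 hInt1
  have henergy := hψ.exp_mul_integral_sq_le_weightedEnergy hL.le hM.le hε0 hT0.le
  have hupper := integral_exp_mul_sq_comp_div_le (g := fun t => ψx t 0) hε0 hT0.le hb0.le hb1
    hInt2 hInt3
  set I := ∫ x in (0 : ℝ)..L, ψ T x ^ 2
  set J := ∫ t in (0 : ℝ)..T, ψx t 0 ^ 2
  set p := Real.exp (-(L ^ 2 / (2 * a * T) / ε)) with hp
  set q := Real.exp (M ^ 2 * T / (2 * ε)) with hq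
  set r := Real.exp (b * M ^ 2 * T / (2 * ε)) with hr
  have hexp : Real.exp ((L ^ 2 / (2 * a * T) - M ^ 2 * T / 2 + b * M ^ 2 * T / 2) / ε) =
      r / (p * q) := by
    rw [hp, hq, hr, ← Real.exp_add, ← Real.exp_sub]
    congr 1
    field_simp
    ring
  have hp0 : 0 < p := Real.exp_pos _
  have hq0 : 0 < q := Real.exp_pos _
  have hchain : (1 - a) * (ε * T) * (p * (q * I)) ≤ C * (ε * r * J) :=
    calc (1 - a) * (ε * T) * (p * (q * I))
        ≤ (1 - a) * (ε * T) * (p * weightedEnergy L M ε ψ T) := by gcongr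
      _ ≤ _ := hlower.trans hobs
      _ ≤ _ := by gcongr
  rw [hexp, div_div, div_mul_eq_mul_div, div_mul_eq_mul_div, le_div_iff₀ (by positivity)]
  refine le_of_mul_le_mul_left ?_ hε0
  linarith
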